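/- There exists n₀ ∈ ℕ such that for all n ≥ n₀ the following holds. Let K ≥ 2 and set k = 2K; assume k is a power of two and k ≤ log₂ n. Then every permutation g of Z₂ⁿ that is a product of K pairwise disjoint transpositions can be realized by a reversible circuit with n inputs (no additional inputs), consisting of gates from Ωₙ², whose depth is at most 2·log₂ n + k·(2^{k+1} + 32·log₂ k) + 8·(n − log₂ k) + 6. -/

import Mathlib

namespace RevCirc

/-- A reversible gate on `n` wires: a target coordinate together with a set of
at most two control coordinates not containing the target.  With no controls it
is a NOT gate, with one control a CNOT gate and with two controls a 2-CNOT
(Toffoli) gate. -/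
abbrev Gate (n : ℕ) : Type :=
  {p : Fin n × Finset (Fin n) // p.2.card ≤ 2 ∧ p.1 ∉ p.2}

def Gate.target {n : ℕ} (g : Gate n) : Fin n := g.1.1

def Gate.controls {n : ℕ} (g : Gate n) : Finset (Fin n) := g.1.2

/-- The transformation of `ℤ₂ⁿ` defined by a gate: the target coordinate is
XOR-ed with the conjunction of the control coordinates. -/
def Gate.apply {n : ℕ} (g : Gate n) (x : Fin n → Bool) : Fin n → Bool :=
  fun i => if i = g.target then xor (x i) (decide (∀ j ∈ g.controls, x j = true)) else x i

/-- The transformation defined by a circuit (a list of gates, applied left to right). -/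
def evalCircuit {n : ℕ} (c : List (Gate n)) (x : Fin n → Bool) : Fin n → Bool :=
  c.foldl (fun y g => g.apply y) x

/-- A circuit realizes a permutation `h` of `ℤ₂ⁿ` (without additional inputs) if the
composition of its gates equals `h`. -/
def realizes {n : ℕ} (c : List (Gate n)) (h : Equiv.Perm (Fin n → Bool)) : Prop :=
  ∀ x, evalCircuit c x = h x

/-- The expanding function `ℤ₂ⁿ → ℤ₂^{n+q}` padding with zeros. -/
def expand (n q : ℕ) (x : Fin n → Bool) : Fin (n + q) → Bool :=
  fun i => if h : (i : ℕ) < n then x ⟨i, h⟩ else false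

/-- A circuit with `n+q` inputs implements `f : ℤ₂ⁿ → ℤ₂ⁿ` using `q` additional
inputs if for some permutation `π` of the wires, the coordinates `π(1),…,π(n)` of the
output on the zero-padded input give `f`. -/
def implements (n q : ℕ) (c : List (Gate (n + q)))
    (f : (Fin n → Bool) → (Fin n → Bool)) : Prop :=
  ∃ π : Equiv.Perm (Fin (n + q)), ∀ x : Fin n → Bool, ∀ i : Fin n,
    evalCircuit c (expand n q x) (π (Fin.castLE (Nat.le_add_right n q) i)) = f x i

/-- `F(n,q)`: the set of transformations `ℤ₂ⁿ → ℤ₂ⁿ` implementable by reversible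
circuits with `n+q` inputs. -/
def FSet (n q : ℕ) : Set ((Fin n → Bool) → (Fin n → Bool)) :=
  {f | ∃ c : List (Gate (n + q)), implements n q c f}

/-- The set of wires touched by a gate: its target together with its controls. -/
def Gate.support {n : ℕ} (g : Gate n) : Finset (Fin n) := insert g.target g.controls

/-- A circuit has depth 1 if the supports of its gates are pairwise disjoint. -/
def DepthOne {n : ℕ} (c : List (Gate n)) : Prop :=
  c.Pairwise fun g₁ g₂ => Disjoint g₁.support g₂.support

/-- The depth of a circuit: the minimal number of consecutive depth-1 sub-circuits
into which it can be divided. -/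
noncomputable def depth {n : ℕ} (c : List (Gate n)) : ℕ :=
  sInf {d | ∃ parts : List (List (Gate n)),
    parts.flatten = c ∧ (∀ p ∈ parts, DepthOne p) ∧ parts.length = d}

/-- The quantum weight of a circuit: each NOT and CNOT gate weighs `WC`, each
2-CNOT gate weighs `WT`. -/
def weight {n : ℕ} (WC WT : ℝ) (c : List (Gate n)) : ℝ :=
  (c.map fun g => if g.controls.card = 2 then WT else WC).sum

/-- `L(f,q)`: minimal gate complexity of a circuit implementing `f` with `q`
additional inputs. -/
noncomputable def Lmin (n q : ℕ) (f : (Fin n → Bool) → (Fin n → Bool)) : ℕ :=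
  sInf {l | ∃ c : List (Gate (n + q)), implements n q c f ∧ c.length = l}

/-- The Shannon gate complexity function `L(n,q)`. -/
noncomputable def ShannonL (n q : ℕ) : ℕ := sSup (Lmin n q '' FSet n q)

/-- `D(f,q)`: minimal depth of a circuit implementing `f` with `q` additional inputs. -/
noncomputable def Dmin (n q : ℕ) (f : (Fin n → Bool) → (Fin n → Bool)) : ℕ :=
  sInf {d | ∃ c : List (Gate (n + q)), implements n q c f ∧ depth c = d}

/-- The Shannon depth function `D(n,q)`. -/
noncomputable def ShannonD (n q : ℕ) : ℕ := sSup (Dmin n q '' FSet n q)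

/-- `W(f,q)`: minimal quantum weight of a circuit implementing `f` with `q`
additional inputs. -/
noncomputable def Wmin (WC WT : ℝ) (n q : ℕ) (f : (Fin n → Bool) → (Fin n → Bool)) : ℝ :=
  sInf {w | ∃ c : List (Gate (n + q)), implements n q c f ∧ weight WC WT c = w}

/-- The Shannon quantum weight function `W(n,q)`. -/
noncomputable def ShannonW (WC WT : ℝ) (n q : ℕ) : ℝ := sSup (Wmin WC WT n q '' FSet n q)

/-- A permutation is a product of `K` pairwise disjoint (independent) transpositions:
there are `2K` pairwise distinct points `x i, y i` with `g = (x 1, y 1)∘⋯∘(x K, y K)`. -/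
def IsProdOfDisjointTranspositions {X : Type*} [DecidableEq X] (K : ℕ)
    (g : Equiv.Perm X) : Prop :=
  ∃ x y : Fin K → X,
    Function.Injective (Sum.elim x y) ∧
    g = ((List.finRange K).map fun i => Equiv.swap (x i) (y i)).prod

end RevCirc

namespace RevCirc

/-- `f` is computed by a circuit consisting of at most `d` layers. -/
def Real' {n : ℕ} (d : ℕ) (f : (Fin n → Bool) → (Fin n → Bool)) : Prop :=
  ∃ parts : List (List (Gate n)), (∀ p ∈ parts, DepthOne p) ∧ parts.length ≤ d ∧
    ∀ x, evalCircuit parts.flatten x = f x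

lemma evalCircuit_append {n : ℕ} (c d : List (Gate n)) (x : Fin n → Bool) :
    evalCircuit (c ++ d) x = evalCircuit d (evalCircuit c x) := by
  simp [evalCircuit, List.foldl_append]

lemma Real'.mono {n d e : ℕ} {f : (Fin n → Bool) → (Fin n → Bool)} (h : Real' d f) (hde : d ≤ e) :
    Real' e f := by
  obtain ⟨p, h1, h2, h3⟩ := h
  exact ⟨p, h1, h2.trans hde, h3⟩

lemma Real'.congr {n d : ℕ} {f g : (Fin n → Bool) → (Fin n → Bool)} (h : Real' d f)
    (hfg : ∀ x, f x = g x) : Real' d g := by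
  obtain ⟨p, h1, h2, h3⟩ := h
  exact ⟨p, h1, h2, fun x => (h3 x).trans (hfg x)⟩

lemma Real'.comp {n d e : ℕ} {f g : (Fin n → Bool) → (Fin n → Bool)} (hf : Real' d f)
    (hg : Real' e g) : Real' (d + e) (fun x => g (f x)) := by
  obtain ⟨p, h1, h2, h3⟩ := hf
  obtain ⟨p', h1', h2', h3'⟩ := hg
  refine ⟨p ++ p', ?_, ?_, ?_⟩
  · intro q hq
    rcases List.mem_append.1 hq with h | h
    · exact h1 q h
    · exact h1' q h
  · simp; omega
  · intro x
    rw [List.flatten_append, evalCircuit_append, h3, h3']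

lemma real_id {n : ℕ} : Real' (n := n) 0 (fun x => x) :=
  ⟨[], by simp, by simp, by simp [evalCircuit]⟩

lemma real_gate {n : ℕ} (g : Gate n) : Real' 1 g.apply :=
  ⟨[[g]], by simp [DepthOne], by simp, by simp [evalCircuit]⟩

lemma gate_invol {n : ℕ} (g : Gate n) (x : Fin n → Bool) : g.apply (g.apply x) = x := by
  have hc : ∀ j ∈ g.controls, g.apply x j = x j := by
    intro j hj
    have : j ≠ g.target := by
      rintro rfl
      exact g.2.2 hj
    simp [Gate.apply, this]
  have hd : decide (∀ j ∈ g.controls, g.apply x j = true)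
      = decide (∀ j ∈ g.controls, x j = true) := by
    apply decide_eq_decide.2
    constructor
    · intro h j hj
      rw [← hc j hj]; exact h j hj
    · intro h j hj
      rw [hc j hj]; exact h j hj
  funext i
  conv_lhs => unfold Gate.apply
  by_cases hi : i = g.target
  · rw [if_pos hi]
    have h2 : decide (∀ j ∈ g.controls, (if j = g.target then xor (x j) (decide (∀ j ∈ g.controls, x j = true)) else x j) = true)
      = decide (∀ j ∈ g.controls, x j = true) := hd
    rw [h2, if_pos hi]
    simp
  · rw [if_neg hi, if_neg hi]

lemma eval_reverse {n : ℕ} (c : List (Gate n)) : ∀ x : Fin n → Bool,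
    evalCircuit c.reverse (evalCircuit c x) = x := by
  induction c with
  | nil => intro x; simp [evalCircuit]
  | cons g c ih =>
    intro x
    rw [List.reverse_cons, evalCircuit_append]
    have : evalCircuit (g :: c) x = evalCircuit c (g.apply x) := by simp [evalCircuit]
    rw [this, ih]
    simp [evalCircuit, gate_invol]

lemma Real'.inv {n d : ℕ} {f : (Fin n → Bool) → (Fin n → Bool)} (h : Real' d f) :
    ∃ f', Real' d f' ∧ (∀ x, f' (f x) = x) ∧ (∀ x, f (f' x) = x) := by
  obtain ⟨p, h1, h2, h3⟩ := h
  refine ⟨evalCircuit p.flatten.reverse, ⟨(p.map List.reverse).reverse, ?_, ?_, ?_⟩, ?_, ?_⟩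
  · intro q hq
    simp only [List.mem_reverse, List.mem_map] at hq
    obtain ⟨a, ha, rfl⟩ := hq
    have := h1 a ha
    unfold DepthOne at *
    rw [List.pairwise_reverse]
    exact this.imp (fun h => h.symm)
  · simpa using h2
  · intro x
    rw [List.reverse_flatten]
  · intro x
    rw [← h3, eval_reverse]
  · intro x
    rw [← h3]
    have := eval_reverse p.flatten.reverse x
    rwa [List.reverse_reverse] at this

lemma Real'.depth_le {n d : ℕ} {f : (Fin n → Bool) → (Fin n → Bool)} (h : Real' d f) :
    ∃ c : List (Gate n), (∀ x, evalCircuit c x = f x) ∧ depth c ≤ d := by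
  obtain ⟨p, h1, h2, h3⟩ := h
  refine ⟨p.flatten, h3, le_trans (Nat.sInf_le ⟨p, rfl, h1, rfl⟩) h2⟩

/-- A layer of gates. -/
lemma real_layer {n : ℕ} (G : Fin n → Gate n) (T : Finset (Fin n))
    (ht : ∀ t ∈ T, (G t).target = t)
    (hd : ∀ t ∈ T, ∀ s ∈ T, t ≠ s → Disjoint (G t).support (G s).support) :
    Real' 1 (fun x i => if i ∈ T then (G i).apply x i else x i) := by
  suffices h : ∃ c : List (Gate n), (∀ g ∈ c, ∃ t ∈ T, g = G t) ∧ DepthOne c ∧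
      ∀ x i, evalCircuit c x i = if i ∈ T then (G i).apply x i else x i by
    obtain ⟨c, -, h1, h2⟩ := h
    exact ⟨[c], by simpa using h1, by simp, fun x => by funext i; simp [h2]⟩
  induction T using Finset.induction_on with
  | empty => exact ⟨[], by simp, by simp [DepthOne], by simp [evalCircuit]⟩
  | insert a T ha ih =>
    obtain ⟨c, hc1, hc2, hc3⟩ := ih (fun t h => ht t (Finset.mem_insert_of_mem h))
      (fun t h s h' => hd t (Finset.mem_insert_of_mem h) s (Finset.mem_insert_of_mem h'))
    have hta := ht a (Finset.mem_insert_self _ _)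
    refine ⟨c ++ [G a], ?_, ?_, ?_⟩
    · intro g hg
      rcases List.mem_append.1 hg with h | h
      · obtain ⟨t, h1, h2⟩ := hc1 g h
        exact ⟨t, Finset.mem_insert_of_mem h1, h2⟩
      · exact ⟨a, Finset.mem_insert_self _ _, by simpa using h⟩
    · unfold DepthOne
      rw [List.pairwise_append]
      refine ⟨hc2, by simp, ?_⟩
      intro g hg g' hg'
      obtain ⟨t, h1, rfl⟩ := hc1 g hg
      have : g' = G a := by simpa using hg'
      subst this
      exact hd t (Finset.mem_insert_of_mem h1) a (Finset.mem_insert_self _ _)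
        (by rintro rfl; exact ha h1)
    · intro x i
      rw [evalCircuit_append]
      have h0 : evalCircuit [G a] (evalCircuit c x) = (G a).apply (evalCircuit c x) := by
        simp [evalCircuit]
      rw [h0]
      by_cases hi : i = a
      · subst hi
        have hcon : ∀ j ∈ (G i).controls, evalCircuit c x j = x j := by
          intro j hj
          rw [hc3, if_neg]
          intro hjT
          have hdis := hd i (Finset.mem_insert_self _ _) j (Finset.mem_insert_of_mem hjT)
            (by rintro rfl; exact ha hjT)
          have hj' : j ∈ (G i).support := by simp [Gate.support, hj]
          refine Finset.disjoint_left.1 hdis hj' ?_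
          simp [Gate.support, ht j (Finset.mem_insert_of_mem hjT)]
        simp only [Gate.apply, hta, if_true, Finset.mem_insert_self]
        have e1 : evalCircuit c x i = x i := by rw [hc3, if_neg ha]
        have e2 : decide (∀ j ∈ (G i).controls, evalCircuit c x j = true) =
            decide (∀ j ∈ (G i).controls, x j = true) := by
          apply decide_eq_decide.2
          constructor
          · intro h j hj
            rw [← hcon j hj]; exact h j hj
          · intro h j hj
            rw [hcon j hj]; exact h j hj
        rw [e1, e2]
      · have : (G a).apply (evalCircuit c x) i = evalCircuit c x i := by
          simp [Gate.apply, hta, hi]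
        rw [this, hc3]
        simp [Finset.mem_insert, hi]

/-- A layer of NOT gates. -/
lemma real_not {n : ℕ} (T : Finset (Fin n)) :
    Real' 1 (fun x i => if i ∈ T then !(x i) else x i) := by
  refine (real_layer (fun t => (⟨(t, ∅), by simp⟩ : Gate n)) T ?_ ?_).congr ?_
  · intro t _; rfl
  · intro t _ s _ h
    simpa [Gate.support, Gate.target, Gate.controls] using h
  · intro x
    funext i
    simp [Gate.apply, Gate.target, Gate.controls]

/-- A layer of CNOT gates. -/
lemma real_cnots {n : ℕ} (T : Finset (Fin n)) (ctrl : Fin n → Fin n)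
    (h1 : ∀ t ∈ T, ctrl t ∉ T) (h2 : ∀ t ∈ T, ∀ s ∈ T, ctrl t = ctrl s → t = s) :
    Real' 1 (fun x i => if i ∈ T then xor (x i) (x (ctrl i)) else x i) := by
  classical
  refine (real_layer (fun t => if h : t ∈ T then
    (⟨(t, {ctrl t}), by simp, by
      simp only [Finset.mem_singleton]; intro h'; exact h1 t h (h' ▸ h)⟩ : Gate n)
      else ⟨(t, ∅), by simp⟩) T ?_ ?_).congr ?_
  · intro t ht
    simp [ht, Gate.target]
  · intro t ht s hs hne
    simp only [ht, hs, dif_pos, Gate.support, Gate.target, Gate.controls]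
    rw [Finset.disjoint_left]
    intro a ha hb
    simp only [Finset.mem_insert, Finset.mem_singleton] at ha hb
    rcases ha with rfl | rfl <;> rcases hb with hb | hb
    · exact hne hb
    · exact h1 s hs (hb ▸ ht)
    · exact h1 t ht (hb ▸ hs)
    · exact hne (h2 t ht s hs hb)
  · intro x
    funext i
    by_cases hi : i ∈ T
    · simp [hi, Gate.apply, Gate.target, Gate.controls]
    · simp [hi]

/-- Sequential fan-out. -/
lemma real_fan {n : ℕ} (a : Fin n) (S : Finset (Fin n)) (ha : a ∉ S) :
    Real' S.card (fun x i => if i ∈ S then xor (x i) (x a) else x i) := by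
  induction S using Finset.induction_on with
  | empty => exact real_id.congr (by simp)
  | insert b S hb ih =>
    have hab : a ≠ b := by rintro rfl; simp at ha
    have haS : a ∉ S := fun h => ha (Finset.mem_insert_of_mem h)
    rw [Finset.card_insert_of_notMem hb]
    refine ((ih haS).comp (real_cnots {b} (fun _ => a) (by simpa using hab) (by simp))).congr ?_
    intro x
    funext i
    by_cases hi : i = b
    · subst hi
      simp [hb, haS]
    · simp [hi]

/-- multi-controlled NOT -/
def mcx {n : ℕ} (C : Finset (Fin n)) (t : Fin n) (x : Fin n → Bool) : Fin n → Bool :=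
  fun i => if i = t then xor (x i) (decide (∀ j ∈ C, x j = true)) else x i

lemma real_mcx2 {n : ℕ} (C : Finset (Fin n)) (t : Fin n) (hC : C.card ≤ 2) (ht : t ∉ C) :
    Real' 1 (mcx C t) :=
  (real_gate ⟨(t, C), hC, ht⟩).congr (fun _ => rfl)

lemma real_W {n : ℕ} (a d : ℕ → Fin n) (j : ℕ)
    (hdd : ∀ i ≤ j, ∀ l ≤ j, d i = d l → i = l)
    (hda : ∀ i ≤ j, ∀ l ≤ j + 1, d i ≠ a l) :
    ∃ f, Real' (2 * j + 1) f ∧ ∀ x : Fin n → Bool,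
      (∀ w, (∀ i ≤ j, w ≠ d i) → f x w = x w) ∧
      (∀ i ≤ j, f x (d i) = xor (x (d i)) (decide (∀ l ≤ i + 1, x (a l) = true))) := by
  induction j with
  | zero =>
    refine ⟨mcx {a 0, a 1} (d 0), real_mcx2 _ _ Finset.card_le_two ?_, ?_⟩
    · simp only [Finset.mem_insert, Finset.mem_singleton, not_or]
      exact ⟨hda 0 le_rfl 0 (by simp), hda 0 le_rfl 1 (by simp)⟩
    · intro x
      constructor
      · intro w hw
        simp [mcx, hw 0 le_rfl]
      · intro i hi
        obtain rfl : i = 0 := by omega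
        simp only [mcx, if_true]
        congr 1
        apply decide_eq_decide.2
        constructor
        · intro h l hl
          have : l = 0 ∨ l = 1 := by omega
          rcases this with rfl | rfl <;> apply h <;> simp
        · intro h l hl
          simp only [Finset.mem_insert, Finset.mem_singleton] at hl
          rcases hl with rfl | rfl <;> apply h <;> simp
  | succ j ih =>
    obtain ⟨f, hf, hfx⟩ := ih (fun i hi l hl => hdd i (by omega) l (by omega))
      (fun i hi l hl => hda i (by omega) l (by omega))
    have hne : d (j+1) ≠ d j := fun h => by
      have := hdd _ le_rfl _ (by omega) h
      omega
    have hnea : d (j+1) ≠ a (j+2) := hda _ le_rfl _ (by omega)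
    have hG : Real' 1 (mcx {a (j+2), d j} (d (j+1))) := by
      refine real_mcx2 _ _ Finset.card_le_two ?_
      simp only [Finset.mem_insert, Finset.mem_singleton, not_or]
      exact ⟨hnea, hne⟩
    refine ⟨_, ((hG.comp hf).comp hG).mono (by omega), ?_⟩
    intro x
    set y := mcx {a (j+2), d j} (d (j+1)) x with hy
    have hy1 : ∀ w, w ≠ d (j+1) → y w = x w := fun w hw => by simp [hy, mcx, hw]
    have hya : ∀ l ≤ j + 2, y (a l) = x (a l) := fun l hl =>
      hy1 _ (fun h => hda _ le_rfl _ hl h.symm)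
    have hdj : ∀ i ≤ j, d i ≠ d (j+1) := fun i hi h => by
      have := hdd _ (by omega) _ le_rfl h
      omega
    obtain ⟨h1, h2⟩ := hfx y
    have h3 : ∀ w, w ≠ d (j+1) → mcx {a (j+2), d j} (d (j+1)) (f y) w = f y w :=
      fun w hw => by simp [mcx, hw]
    have hdec : ∀ i ≤ j, decide (∀ l ≤ i + 1, y (a l) = true) =
        decide (∀ l ≤ i + 1, x (a l) = true) := by
      intro i hi
      apply decide_eq_decide.2
      constructor
      · intro h l hl
        rw [← hya l (by omega)]; exact h l hl
      · intro h l hl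
        rw [hya l (by omega)]; exact h l hl
    constructor
    · intro w hw
      rw [h3 w (hw _ le_rfl), h1 w (fun i hi => hw i (by omega)), hy1 w (hw _ le_rfl)]
    · intro i hi
      by_cases hij : i = j + 1
      · subst hij
        have e1 : f y (d (j+1)) = y (d (j+1)) := h1 _ (fun i hi h => hdj i hi h.symm)
        have e2 : f y (a (j+2)) = x (a (j+2)) := by
          rw [h1 _ (fun i hi h => hda i (by omega) _ le_rfl h.symm), hya _ le_rfl]
        have e3 : f y (d j) = xor (x (d j)) (decide (∀ l ≤ j + 1, x (a l) = true)) := by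
          rw [h2 j le_rfl, hdec j le_rfl, hy1 _ (hdj j le_rfl)]
        have e4 : y (d (j+1)) = xor (x (d (j+1))) (x (a (j+2)) && x (d j)) := by
          simp [hy, mcx]
        have e5 : mcx {a (j+2), d j} (d (j+1)) (f y) (d (j+1)) =
            xor (f y (d (j+1))) (f y (a (j+2)) && f y (d j)) := by
          simp [mcx]
        have e6 : decide (∀ l ≤ j + 1 + 1, x (a l) = true) =
            (x (a (j+2)) && decide (∀ l ≤ j + 1, x (a l) = true)) := by
          rw [Bool.eq_iff_iff]
          simp only [decide_eq_true_eq, Bool.and_eq_true]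
          constructor
          · intro h
            exact ⟨h _ le_rfl, fun l hl => h l (by omega)⟩
          · rintro ⟨h, h'⟩ l hl
            by_cases hl' : l = j + 2
            · rw [hl']; exact h
            · exact h' l (by omega)
        rw [e5, e6, e1, e2, e3, e4]
        generalize x (d (j+1)) = b1
        generalize x (a (j+2)) = b2
        generalize x (d j) = b3
        generalize decide (∀ l ≤ j + 1, x (a l) = true) = b4
        revert b1 b2 b3 b4
        decide
      · have hi' : i ≤ j := by omega
        rw [h3 _ (hdj i hi'), h2 i hi', hdec i hi', hy1 _ (hdj i hi')]

lemma real_T {n : ℕ} (a d : ℕ → Fin n) (j : ℕ)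
    (hdd : ∀ i ≤ j, ∀ l ≤ j, d i = d l → i = l)
    (hda : ∀ i ≤ j, ∀ l ≤ j + 1, d i ≠ a l) :
    Real' (4 * j + 1) (fun (x : Fin n → Bool) w => if w = d j then
      xor (x w) (decide (∀ l ≤ j + 1, x (a l) = true)) else x w) := by
  obtain ⟨f, hf, hfx⟩ := real_W a d j hdd hda
  cases j with
  | zero =>
    refine hf.congr ?_
    intro x
    funext w
    by_cases hw : w = d 0
    · subst hw
      rw [if_pos rfl, (hfx x).2 0 le_rfl]
    · rw [if_neg hw, (hfx x).1]
      intro i hi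
      obtain rfl : i = 0 := by omega
      exact hw
  | succ j =>
    obtain ⟨f', hf', hfx'⟩ := real_W a d j (fun i hi l hl => hdd i (by omega) l (by omega))
      (fun i hi l hl => hda i (by omega) l (by omega))
    refine ((hf.comp hf').mono (by omega)).congr ?_
    intro x
    have hfa : ∀ l ≤ j + 2, f x (a l) = x (a l) := fun l hl =>
      (hfx x).1 _ (fun i hi h => hda i hi l hl h.symm)
    funext w
    by_cases hw : w = d (j+1)
    · subst hw
      rw [if_pos rfl, (hfx' _).1, (hfx x).2 _ le_rfl]
      intro i hi h
      have := hdd _ le_rfl _ (by omega) h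
      omega
    · rw [if_neg hw]
      by_cases hw' : ∃ i ≤ j, w = d i
      · obtain ⟨i, hi, rfl⟩ := hw'
        rw [(hfx' _).2 i hi, (hfx x).2 i (by omega)]
        have hdec : decide (∀ l ≤ i + 1, f x (a l) = true) =
            decide (∀ l ≤ i + 1, x (a l) = true) := by
          apply decide_eq_decide.2
          constructor
          · intro h l hl
            rw [← hfa l (by omega)]; exact h l hl
          · intro h l hl
            rw [hfa l (by omega)]; exact h l hl
        rw [hdec]
        simp
      · push Not at hw'
        rw [(hfx' _).1 w hw', (hfx x).1]
        intro i hi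
        by_cases hij : i = j + 1
        · rw [hij]; exact hw
        · exact hw' i (by omega)

lemma enum_finset {n : ℕ} (t : Fin n) (C : Finset (Fin n)) : ∃ a : ℕ → Fin n,
    (∀ i < C.card, ∀ j < C.card, a i = a j → i = j) ∧ (∀ i < C.card, a i ∈ C) ∧
    (∀ w ∈ C, ∃ i < C.card, a i = w) := by
  refine ⟨fun i => if h : i < C.card then (C.equivFin.symm ⟨i, h⟩ : Fin n) else t, ?_, ?_, ?_⟩
  · intro i hi j hj h
    simp only [hi, hj, dif_pos] at h
    have := C.equivFin.symm.injective (Subtype.ext h)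
    simpa using this
  · intro i hi
    simp [hi]
  · intro w hw
    refine ⟨C.equivFin ⟨w, hw⟩, (C.equivFin ⟨w, hw⟩).2, ?_⟩
    simp

lemma real_mcx {n : ℕ} (C D : Finset (Fin n)) (t : Fin n) (h2 : 2 ≤ C.card)
    (htC : t ∉ C) (htD : t ∉ D) (hCD : Disjoint C D) (hcard : C.card ≤ D.card + 2) :
    Real' (4 * C.card - 7) (mcx C t) := by
  obtain ⟨a, ha1, ha2, ha3⟩ := enum_finset t C
  obtain ⟨d, hd1, hd2, -⟩ := enum_finset t D
  obtain ⟨j, hj⟩ : ∃ j, C.card = j + 2 := ⟨C.card - 2, by omega⟩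
  have key := real_T a (fun i => if i < j then d i else t) j ?_ ?_
  · refine (key.mono (by omega)).congr ?_
    intro x
    funext w
    simp only [lt_irrefl, if_false, mcx]
    by_cases hw : w = t
    · rw [if_pos hw, if_pos hw]
      congr 1
      apply decide_eq_decide.2
      constructor
      · intro h w hw
        obtain ⟨i, hi, rfl⟩ := ha3 w hw
        exact h i (by omega)
      · intro h l hl
        exact h _ (ha2 l (by omega))
    · rw [if_neg hw, if_neg hw]
  · intro i hi l hl h
    split_ifs at h with h1 h2 h2
    · exact hd1 i (by omega) l (by omega) h
    · exact absurd (h ▸ hd2 i (by omega)) htD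
    · exact absurd (h ▸ hd2 l (by omega)) htD
    · omega
  · intro i hi l hl h
    have hal := ha2 l (by omega)
    split_ifs at h with h1
    · exact Finset.disjoint_left.1 hCD hal (h ▸ hd2 i (by omega))
    · exact htC (h ▸ hal)

lemma real_mcx_one {n : ℕ} (C : Finset (Fin n)) (t e : Fin n) (h4 : 4 ≤ C.card)
    (htC : t ∉ C) (heC : e ∉ C) (hte : t ≠ e) : Real' (8 * C.card - 20) (mcx C t) := by
  obtain ⟨C1, hC1, hc1⟩ := Finset.exists_subset_card_eq (s := C) (n := C.card / 2) (by omega)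
  set C2 := C \ C1 with hC2
  have hc2 : C2.card = C.card - C.card / 2 := by
    rw [hC2, Finset.card_sdiff_of_subset hC1, hc1]
  have hsub2 : C2 ⊆ C := Finset.sdiff_subset
  have hdis : Disjoint C1 C2 := Finset.disjoint_sdiff
  have heC2 : e ∉ C2 := fun h => heC (hsub2 h)
  have hins : (insert e C2).card = C2.card + 1 := Finset.card_insert_of_notMem heC2
  have r1 := real_mcx C1 C2 e (by omega) (fun h => heC (hC1 h)) heC2 hdis (by omega)
  have r2 := real_mcx (insert e C2) C1 t (by omega)
    (by simp only [Finset.mem_insert, not_or]; exact ⟨hte, fun h => htC (hsub2 h)⟩)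
    (fun h => htC (hC1 h))
    (by
      rw [Finset.disjoint_insert_left]
      exact ⟨fun h => heC (hC1 h), hdis.symm⟩) (by omega)
  refine ((((r1.comp r2).comp r1).comp r2).mono (by omega)).congr ?_
  intro x
  -- pointwise description of the two steps
  have s1 : ∀ y : Fin n → Bool, (∀ j ∈ C, y j = x j) → mcx C1 e y =
      fun i => if i = e then xor (y i) (decide (∀ j ∈ C1, x j = true)) else y i := by
    intro y hy
    funext i
    simp only [mcx]
    have : decide (∀ j ∈ C1, y j = true) = decide (∀ j ∈ C1, x j = true) := by
      apply decide_eq_decide.2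
      constructor
      · intro h j hj
        rw [← hy j (hC1 hj)]; exact h j hj
      · intro h j hj
        rw [hy j (hC1 hj)]; exact h j hj
    rw [this]
  have s2 : ∀ y : Fin n → Bool, (∀ j ∈ C, y j = x j) → mcx (insert e C2) t y =
      fun i => if i = t then xor (y i) (y e && decide (∀ j ∈ C2, x j = true)) else y i := by
    intro y hy
    funext i
    simp only [mcx]
    have : decide (∀ j ∈ insert e C2, y j = true) =
        (y e && decide (∀ j ∈ C2, x j = true)) := by
      rw [Bool.eq_iff_iff]
      simp only [decide_eq_true_eq, Bool.and_eq_true, Finset.mem_insert]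
      constructor
      · intro h
        exact ⟨h _ (Or.inl rfl), fun j hj => by rw [← hy j (hsub2 hj)]; exact h j (Or.inr hj)⟩
      · rintro ⟨h, h'⟩ j (rfl | hj)
        · exact h
        · rw [hy j (hsub2 hj)]; exact h' j hj
    rw [this]
  have hall : decide (∀ j ∈ C, x j = true) =
      (decide (∀ j ∈ C1, x j = true) && decide (∀ j ∈ C2, x j = true)) := by
    rw [Bool.eq_iff_iff]
    simp only [decide_eq_true_eq, Bool.and_eq_true]
    constructor
    · intro h
      exact ⟨fun j hj => h j (hC1 hj), fun j hj => h j (hsub2 hj)⟩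
    · rintro ⟨h, h'⟩ j hj
      by_cases hj1 : j ∈ C1
      · exact h j hj1
      · exact h' j (Finset.mem_sdiff.2 ⟨hj, hj1⟩)
  have neE : ∀ j ∈ C, j ≠ e := fun j hj h => heC (h ▸ hj)
  have neT : ∀ j ∈ C, j ≠ t := fun j hj h => htC (h ▸ hj)
  have c1 : ∀ y : Fin n → Bool, (∀ j ∈ C, y j = x j) → ∀ j ∈ C, mcx C1 e y j = x j := by
    intro y hy j hj
    simp [mcx, neE j hj, hy j hj]
  have c2 : ∀ y : Fin n → Bool, (∀ j ∈ C, y j = x j) →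
      ∀ j ∈ C, mcx (insert e C2) t y j = x j := by
    intro y hy j hj
    simp [mcx, neT j hj, hy j hj]
  have k0 : ∀ j ∈ C, x j = x j := fun _ _ => rfl
  have k1 := c1 x k0
  have k2 := c2 _ k1
  have k3 := c1 _ k2
  rw [s2 _ k3, s1 _ k2, s2 _ k1, s1 _ k0]
  funext i
  simp only [mcx, hall]
  generalize decide (∀ j ∈ C1, x j = true) = b1
  generalize decide (∀ j ∈ C2, x j = true) = b2
  have het : e ≠ t := hte.symm
  by_cases hi : i = t
  · subst hi
    simp only [if_true, hte, het, if_false]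
    generalize x i = b3
    generalize x e = b4
    revert b1 b2 b3 b4
    decide
  · by_cases hi' : i = e
    · subst hi'
      simp [het]
    · simp [hi', hi]

/-- flip `t` iff the restriction to `B` equals that of `u`. -/
def eqx {n : ℕ} (B : Finset (Fin n)) (u : Fin n → Bool) (t : Fin n) (x : Fin n → Bool) :
    Fin n → Bool :=
  fun i => if i = t then xor (x i) (decide (∀ j ∈ B, x j = u j)) else x i

lemma real_eqx {n : ℕ} (B : Finset (Fin n)) (u : Fin n → Bool) (t : Fin n) (h2 : 2 ≤ B.card)
    (hn : 2 * B.card ≤ n) (ht : t ∉ B) : Real' (4 * B.card) (eqx B u t) := by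
  set D := (Finset.univ \ insert t B : Finset (Fin n)) with hD
  have hDc : D.card = n - (B.card + 1) := by
    rw [hD, Finset.card_sdiff_of_subset (Finset.subset_univ _), Finset.card_insert_of_notMem ht]
    simp
  have r1 := real_mcx B D t h2 ht (by simp [hD])
    (by
      rw [Finset.disjoint_left]
      intro a ha hb
      simp [hD, ha] at hb) (by omega)
  have r0 := real_not (B.filter (fun j => u j = false))
  refine (((r0.comp r1).comp r0).mono (by omega)).congr ?_
  intro x
  funext i
  simp only [mcx, eqx]
  have hdec : decide (∀ j ∈ B, (if j ∈ B.filter (fun j => u j = false) then !(x j) else x j) = true)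
      = decide (∀ j ∈ B, x j = u j) := by
    apply decide_eq_decide.2
    refine forall₂_congr ?_
    intro j hj
    cases hu : u j <;> simp [hj, hu]
  rw [hdec]
  by_cases hi : i = t
  · subst hi
    simp [ht]
  · by_cases hf : i ∈ B.filter (fun j => u j = false)
    · simp [hf, hi]
    · simp [hf, hi]

/-- Placement of the points one by one. -/
lemma stage2 {n : ℕ} {ι : Type*} [DecidableEq ι] (B A : Finset (Fin n)) (z : Fin n)
    (hzA : z ∈ A) (hzB : z ∉ B) (h2 : 2 ≤ B.card) (hn : 2 * B.card ≤ n)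
    (p q : ι → Fin n → Bool) (hp : Function.Injective p) (hq : Function.Injective q)
    (hpz : ∀ v w, w ∉ A → w ∉ B → p v w = false) (hqz : ∀ v w, w ∉ B → q v w = false)
    (S : Finset ι) :
    ∃ f, Real' (S.card * (A.card + 9 * B.card)) f ∧ (∀ v ∈ S, f (p v) = q v) ∧
      (∀ v w, w ∉ A → w ∉ B → f (p v) w = false) := by
  induction S using Finset.induction_on with
  | empty => exact ⟨fun x => x, real_id.mono (by simp), by simp, hpz⟩
  | insert s S hs ih =>
    obtain ⟨f, hf, hf1, hf2⟩ := ih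
    have hfinj : Function.Injective f := by
      obtain ⟨f', -, h, -⟩ := hf.inv
      exact Function.LeftInverse.injective h
    -- first make sure that there is a flag
    have flag : ∃ (f1 : (Fin n → Bool) → (Fin n → Bool)) (a : Fin n), Real' (4 * B.card) f1 ∧
        a ∈ A ∧ a ∉ B ∧ f1 (f (p s)) a = true ∧ (∀ v ∈ S, f1 (q v) = q v) ∧
        (∀ v w, w ∉ A → w ∉ B → f1 (f (p v)) w = false) := by
      by_cases hcase : ∃ w, w ∉ B ∧ f (p s) w = true
      · obtain ⟨w, hwB, hw⟩ := hcase
        refine ⟨fun x => x, w, real_id.mono (by omega), ?_, hwB, hw, fun _ _ => rfl, hf2⟩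
        by_contra hwA
        rw [hf2 s w hwA hwB] at hw
        exact absurd hw (by simp)
      · push Not at hcase
        refine ⟨eqx B (f (p s)) z, z, real_eqx B _ z h2 hn hzB, hzA, hzB, ?_, ?_, ?_⟩
        · have := hcase z hzB
          simp only [Bool.not_eq_true] at this
          simp [eqx, this]
        · intro v hv
          have hne : ¬ ∀ j ∈ B, q v j = f (p s) j := by
            intro h
            have : f (p s) = f (p v) := by
              rw [hf1 v hv]
              funext w
              by_cases hw : w ∈ B
              · exact (h w hw).symm
              · rw [hqz v w hw]
                simpa using hcase w hw
            exact hs (hp (hfinj this) ▸ hv)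
          funext i
          simp only [eqx, decide_eq_false hne]
          simp
        · intro v w hwA hwB
          have : w ≠ z := by rintro rfl; exact hwA hzA
          simp [eqx, this, hf2 v w hwA hwB]
    obtain ⟨f1, a, hf1r, haA, haB, hfa, hf1q, hf1z⟩ := flag
    set y := f1 (f (p s)) with hy
    set T := ((A ∪ B).erase a).filter (fun w => y w ≠ q s w) with hT
    have haT : a ∉ T := by simp [hT]
    have hTc : T.card ≤ A.card + B.card := by
      refine (Finset.card_filter_le _ _).trans (Finset.card_erase_le.trans ?_)
      exact Finset.card_union_le _ _
    have rfan := real_fan a T haT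
    have req := real_eqx B (q s) a h2 hn haB
    have hcost : S.card * (A.card + 9 * B.card) + 4 * B.card + T.card + 4 * B.card ≤
        (insert s S).card * (A.card + 9 * B.card) := by
      rw [Finset.card_insert_of_notMem hs, add_mul]
      omega
    refine ⟨_, (((hf.comp hf1r).comp rfan).comp req).mono hcost, ?_, ?_⟩
    · intro v hv
      rcases Finset.mem_insert.1 hv with rfl | hv
      · have e1 : (fun i => if i ∈ T then xor (y i) (y a) else y i) =
            fun i => if i = a then true else q v i := by
          funext i
          by_cases hia : i = a
          · subst hia
            simp [haT, hfa]
          · by_cases hiT : i ∈ T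
            · have : y i ≠ q v i := (Finset.mem_filter.1 hiT).2
              simp only [hiT, hia, if_true, if_false, hfa]
              revert this
              cases y i <;> cases q v i <;> simp
            · simp only [hiT, hia, if_false]
              by_cases hAB : i ∈ A ∪ B
              · by_contra hne
                exact hiT (Finset.mem_filter.2 ⟨Finset.mem_erase.2 ⟨hia, hAB⟩, hne⟩)
              · simp only [Finset.mem_union, not_or] at hAB
                rw [hqz v i hAB.2]
                exact hf1z v i hAB.1 hAB.2
        simp only [← hy]
        rw [e1]
        funext i
        have hB : ∀ j ∈ B, (if j = a then true else q v j) = q v j := by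
          intro j hj
          rw [if_neg]
          rintro rfl
          exact haB hj
        by_cases hia : i = a
        · subst hia
          simp only [eqx, if_true, decide_eq_true hB, hqz v i haB]
          rfl
        · simp [eqx, hia]
      · simp only [hf1 v hv, hf1q v hv]
        have hqa : q v a = false := hqz v a haB
        have hne : ¬ ∀ j ∈ B, q v j = q s j := by
          intro h
          have : q v = q s := by
            funext w
            by_cases hw : w ∈ B
            · exact h w hw
            · rw [hqz v w hw, hqz s w hw]
          exact hs (hq this ▸ hv)
        have e1 : (fun i => if i ∈ T then xor (q v i) (q v a) else q v i) = q v := by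
          funext i
          simp [hqa]
        rw [e1]
        funext i
        simp only [eqx, decide_eq_false hne]
        simp
    · intro v w hwA hwB
      have hwT : w ∉ T := by simp [hT, hwA, hwB]
      have hwa : w ≠ a := by rintro rfl; exact hwA haA
      simp only [eqx, hwa, if_false, hwT]
      exact hf1z v w hwA hwB

lemma exists_rank {n : ℕ} {κ : Type*} (col : Fin n → κ) : ∃ r : Fin n → ℕ,
    (∀ i, r i < n) ∧ (∀ i j, col i = col j → r i = r j → i = j) ∧
    (∀ i, ∀ s ≤ r i, ∃ j, col j = col i ∧ r j = s) := by
  classical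
  let F : κ → Finset (Fin n) := fun y => Finset.univ.filter (fun i => col i = y)
  have hF : ∀ i, i ∈ F (col i) := fun i => by simp [F]
  let r : Fin n → ℕ := fun i => ((F (col i)).equivFin ⟨i, hF i⟩ : ℕ)
  have hr : ∀ y j (h : j ∈ F y), r j = ((F y).equivFin ⟨j, h⟩ : ℕ) := by
    intro y j h
    have : col j = y := by simpa [F] using h
    subst this
    rfl
  refine ⟨r, ?_, ?_, ?_⟩
  · intro i
    refine lt_of_lt_of_le ((F (col i)).equivFin ⟨i, hF i⟩).2 ?_
    simpa using Finset.card_le_univ (F (col i))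
  · intro i j hc h
    have hj : i ∈ F (col j) := by simp [F, hc]
    rw [hr (col j) i hj, hr (col j) j (hF j)] at h
    have := (F (col j)).equivFin.injective (Fin.ext h)
    simpa using this
  · intro i s hs
    have hlt : s < (F (col i)).card := lt_of_le_of_lt hs ((F (col i)).equivFin ⟨i, hF i⟩).2
    set j := (F (col i)).equivFin.symm ⟨s, hlt⟩ with hj
    refine ⟨j, ?_, ?_⟩
    · exact (Finset.mem_filter.1 j.2).2
    · rw [hr (col i) j j.2]
      simp [hj]

lemma stage1_aux {n : ℕ} {ι : Type*} (p0 : ι → Fin n → Bool) (r : Fin n → ℕ)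
    (h1 : ∀ i j, (∀ v, p0 v i = p0 v j) → r i = r j → i = j)
    (h2 : ∀ i, ∀ s ≤ r i, ∃ j, (∀ v, p0 v j = p0 v i) ∧ r j = s) (t : ℕ) :
    ∀ p : ι → Fin n → Bool, (∀ v w, p v w = if r w < 2 ^ t then p0 v w else false) →
    ∃ f, Real' t f ∧ ∀ v w, f (p v) w = if r w < 1 then p0 v w else false := by
  induction t with
  | zero =>
    intro p hp
    exact ⟨fun x => x, real_id, by simpa using hp⟩
  | succ t ih =>
    intro p hp
    choose c hc using fun i => h2 i (r i - 2 ^ t) (Nat.sub_le _ _)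
    have hpow : 2 ^ (t + 1) = 2 ^ t + 2 ^ t := by ring
    set T := Finset.univ.filter (fun w => 2 ^ t ≤ r w ∧ r w < 2 ^ (t + 1)) with hT
    have hmem : ∀ w, w ∈ T ↔ 2 ^ t ≤ r w ∧ r w < 2 ^ (t + 1) := by simp [hT]
    have hl := real_cnots T c ?_ ?_
    · have hstep : ∀ v w, (fun v w => if w ∈ T then xor (p v w) (p v (c w)) else p v w) v w =
          if r w < 2 ^ t then p0 v w else false := by
        intro v w
        beta_reduce
        by_cases hw : w ∈ T
        · have hw' := (hmem w).1 hw
          have hcw := hc w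
          rw [if_pos hw, if_neg (by omega), hp, hp, if_pos hw'.2, if_pos (by omega), hcw.1 v, Bool.xor_self]
        · rw [if_neg hw, hp]
          rw [hmem] at hw
          by_cases hlt : r w < 2 ^ t
          · rw [if_pos hlt, if_pos (by omega)]
          · rw [if_neg hlt, if_neg (by omega)]
      obtain ⟨f, hf, hf1⟩ := ih _ hstep
      exact ⟨_, (hl.comp hf).mono (by omega), hf1⟩
    · intro w hw hcw
      rw [hmem] at hw hcw
      have := (hc w).2
      omega
    · intro w hw w' hw' h
      rw [hmem] at hw hw'
      apply h1
      · intro v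
        rw [← (hc w).1 v, ← (hc w').1 v, h]
      · have e1 := (hc w).2
        have e2 := (hc w').2
        rw [h] at e1
        omega

lemma stage1 {n : ℕ} {ι : Type*} [Fintype ι] (p : ι → Fin n → Bool) (t : ℕ)
    (ht : n ≤ 2 ^ t) :
    ∃ f, Real' t f ∧ ∃ A : Finset (Fin n), A.card ≤ 2 ^ Fintype.card ι ∧
      ∀ v w, w ∉ A → f (p v) w = false := by
  classical
  obtain ⟨r, hr1, hr2, hr3⟩ := exists_rank (fun w => fun v => p v w)
  obtain ⟨f, hf, hf1⟩ := stage1_aux p r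
    (fun i j h => hr2 i j (funext h))
    (fun i s hs => by
      obtain ⟨j, hj, hj'⟩ := hr3 i s hs
      exact ⟨j, fun v => congrFun hj v, hj'⟩) t p
    (fun v w => by rw [if_pos (lt_of_lt_of_le (hr1 w) ht)])
  refine ⟨f, hf, Finset.univ.filter (fun w => r w < 1), ?_, ?_⟩
  · have : (Finset.univ.filter (fun w => r w < 1)).card ≤
        (Finset.univ : Finset (ι → Bool)).card := by
      refine Finset.card_le_card_of_injOn (fun w v => p v w) (by simp) ?_
      intro i hi j hj h
      simp only [Finset.coe_filter, Finset.mem_univ, true_and, Set.mem_ofPred_eq] at hi hj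
      exact hr2 i j h (by omega)
    simpa using this
  · intro v w hw
    rw [hf1, if_neg]
    simpa using hw

lemma prod_swaps {X : Type*} [DecidableEq X] {K : ℕ} (x y : Fin K → X)
    (hinj : Function.Injective (Sum.elim x y)) (L : List (Fin K)) (hL : L.Nodup) :
    (∀ i ∈ L, (L.map fun i => Equiv.swap (x i) (y i)).prod (x i) = y i) ∧
    (∀ i ∈ L, (L.map fun i => Equiv.swap (x i) (y i)).prod (y i) = x i) ∧
    (∀ z, (∀ i ∈ L, z ≠ x i ∧ z ≠ y i) →
      (L.map fun i => Equiv.swap (x i) (y i)).prod z = z) := by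
  have hxx : ∀ i j, x i = x j → i = j := fun i j h => by
    simpa using @hinj (Sum.inl i) (Sum.inl j) h
  have hyy : ∀ i j, y i = y j → i = j := fun i j h => by
    simpa using @hinj (Sum.inr i) (Sum.inr j) h
  have hxy : ∀ i j, x i ≠ y j := fun i j h => by
    simpa using @hinj (Sum.inl i) (Sum.inr j) h
  induction L with
  | nil => simp
  | cons a L ih =>
    obtain ⟨h1, h2, h3⟩ := ih (List.nodup_cons.1 hL).2
    have ha := (List.nodup_cons.1 hL).1
    refine ⟨?_, ?_, ?_⟩
    · intro i hi
      rw [List.map_cons, List.prod_cons, Equiv.Perm.mul_apply]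
      rcases List.mem_cons.1 hi with rfl | hi
      · rw [h3, Equiv.swap_apply_left]
        intro j hj
        exact ⟨fun h => ha (hxx _ _ h ▸ hj), hxy _ _⟩
      · rw [h1 i hi, Equiv.swap_apply_of_ne_of_ne]
        · exact (hxy _ _).symm
        · exact fun h => ha (hyy _ _ h ▸ hi)
    · intro i hi
      rw [List.map_cons, List.prod_cons, Equiv.Perm.mul_apply]
      rcases List.mem_cons.1 hi with rfl | hi
      · rw [h3, Equiv.swap_apply_right]
        intro j hj
        exact ⟨(hxy _ _).symm, fun h => ha (hyy _ _ h ▸ hj)⟩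
      · rw [h2 i hi, Equiv.swap_apply_of_ne_of_ne]
        · exact fun h => ha (hxx _ _ h ▸ hi)
        · exact hxy _ _
    · intro z hz
      rw [List.map_cons, List.prod_cons, Equiv.Perm.mul_apply,
        h3 z (fun i hi => hz i (List.mem_cons_of_mem _ hi))]
      have := hz a List.mem_cons_self
      exact Equiv.swap_apply_of_ne_of_ne this.1 this.2

lemma main_nat (n m K : ℕ) (hm : 1 ≤ m) (hK : K = 2 ^ m) (hn : 2 ^ (2 * K) ≤ n)
    (g : Equiv.Perm (Fin n → Bool)) (hg : IsProdOfDisjointTranspositions K g) :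
    ∃ c : List (Gate n), realizes c g ∧
      depth c ≤ 2 * (Nat.log 2 n + 1 + 2 * K * (2 ^ (2 * K) + 1 + 9 * (m + 1)) + 1)
        + (8 * (n - (m + 1)) - 20) := by
  obtain ⟨x, y, hinj, hgeq⟩ := hg
  have hmK : m + 1 ≤ K := hK ▸ Nat.lt_two_pow_self
  have hKn : 2 * K < n := lt_of_lt_of_le Nat.lt_two_pow_self hn
  have h16 : 16 ≤ n := by
    refine le_trans ?_ hn
    calc 16 = 2 ^ 4 := by norm_num
      _ ≤ 2 ^ (2 * K) := Nat.pow_le_pow_right (by norm_num) (by omega)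
  have hnbig : 2 * (m + 1) + 4 ≤ n := by
    by_cases hm1 : m = 1
    · omega
    · have h1 : 2 ^ (m + 3) ≤ n := by
        refine le_trans (Nat.pow_le_pow_right (by norm_num) ?_) hn
        omega
      have h2 : m + 3 < 2 ^ (m + 3) := Nat.lt_two_pow_self
      have h3 : 2 ^ (m + 3) = 2 ^ m * 8 := by ring
      have h4 : m < 2 ^ m := Nat.lt_two_pow_self
      omega
  -- the wires carrying the index
  set B : Finset (Fin n) := Finset.univ.filter (fun w => (w : ℕ) < m + 1) with hB
  have hmemB : ∀ w : Fin n, w ∈ B ↔ (w : ℕ) < m + 1 := by simp [hB]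
  have hBc : B.card = m + 1 := by
    rw [hB, Fin.card_filter_val_lt]
    omega
  let t0 : Fin n := ⟨0, by omega⟩
  let e0 : Fin n := ⟨1, by omega⟩
  let z0 : Fin n := ⟨m + 1, by omega⟩
  obtain ⟨e⟩ : Nonempty (Fin K ≃ (Fin m → Bool)) := by
    refine ⟨Fintype.equivOfCardEq ?_⟩
    simp [hK]
  let Q : Bool → Fin K → Fin n → Bool := fun b i w =>
    if (w : ℕ) = 0 then b else if h : (w : ℕ) - 1 < m then e i ⟨w - 1, h⟩ else false
  let q : Fin K ⊕ Fin K → Fin n → Bool := Sum.elim (Q false) (Q true)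
  have hQ0 : ∀ b i, Q b i t0 = b := fun b i => by simp [Q, t0]
  have hQs : ∀ b i (l : Fin m), Q b i ⟨l + 1, by omega⟩ = e i l := by
    intro b i l
    simp [Q]
  have hQinj : ∀ b i b' i', Q b i = Q b' i' → b = b' ∧ i = i' := by
    intro b i b' i' h
    refine ⟨by rw [← hQ0 b i, ← hQ0 b' i', h], e.injective ?_⟩
    funext l
    rw [← hQs b i l, ← hQs b' i' l, h]
  have hQz : ∀ b i w, w ∉ B → Q b i w = false := by
    intro b i w hw
    rw [hmemB] at hw
    simp only [Q]
    rw [if_neg (by omega), dif_neg (by omega)]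
  have hQsurj : ∀ u : Fin n → Bool, ∃ i, ∀ w ∈ B, Q (u t0) i w = u w := by
    intro u
    refine ⟨e.symm (fun l => u ⟨l + 1, by omega⟩), ?_⟩
    intro w hw
    rw [hmemB] at hw
    by_cases hw0 : (w : ℕ) = 0
    · have : w = t0 := Fin.ext hw0
      rw [this, hQ0]
    · simp only [Q]
      rw [if_neg hw0, dif_pos (by omega), Equiv.apply_symm_apply]
      congr 1
      apply Fin.ext
      simp only
      omega
  have hqinj : Function.Injective q := by
    rintro (i | i) (j | j) h
    · rw [(hQinj _ _ _ _ h).2]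
    · exact absurd (hQinj _ _ _ _ h).1 (by simp)
    · exact absurd (hQinj _ _ _ _ h).1 (by simp)
    · rw [(hQinj _ _ _ _ h).2]
  have hqz : ∀ v w, w ∉ B → q v w = false := by
    rintro (i | i) w hw
    · exact hQz _ _ _ hw
    · exact hQz _ _ _ hw
  -- stage 1
  obtain ⟨f1, hf1, A, hA, hf1A⟩ := stage1 (Sum.elim x y) (Nat.log 2 n + 1)
    (Nat.lt_pow_succ_log_self (by norm_num) n).le
  have hcardι : Fintype.card (Fin K ⊕ Fin K) = 2 * K := by simp; ring
  rw [hcardι] at hA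
  have hf1inj : Function.Injective f1 := by
    obtain ⟨f', -, h, -⟩ := hf1.inv
    exact Function.LeftInverse.injective h
  -- stage 2
  obtain ⟨f2, hf2, hf2q, -⟩ := stage2 B (insert z0 A) z0 (Finset.mem_insert_self _ _)
    (by rw [hmemB]; simp [z0]) (by omega) (by omega) (fun v => f1 (Sum.elim x y v)) q
    (hf1inj.comp hinj) hqinj
    (fun v w hw _ => hf1A v w (fun h => hw (Finset.mem_insert_of_mem h))) hqz Finset.univ
  have r3 := real_not Bᶜ
  have hcost : Nat.log 2 n + 1 + (Finset.univ : Finset (Fin K ⊕ Fin K)).card *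
      ((insert z0 A).card + 9 * B.card) + 1 ≤
      Nat.log 2 n + 1 + 2 * K * (2 ^ (2 * K) + 1 + 9 * (m + 1)) + 1 := by
    rw [Finset.card_univ, hcardι, hBc]
    have := Finset.card_insert_le z0 A
    gcongr
    omega
  have hF := (((hf1.comp hf2).comp r3).mono hcost)
  set F : (Fin n → Bool) → (Fin n → Bool) :=
    fun u => (fun x i => if i ∈ Bᶜ then !(x i) else x i) (f2 (f1 u)) with hFdef
  have hFp : ∀ v, F (Sum.elim x y v) = fun i => if i ∈ B then q v i else true := by
    intro v
    funext i
    have := hf2q v (Finset.mem_univ _)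
    simp only [hFdef, this]
    by_cases hi : i ∈ B
    · simp [hi]
    · simp [hi, hqz v i hi]
  obtain ⟨F', hF', hFF, hFF'⟩ := hF.inv
  have ht0B : t0 ∈ B := by rw [hmemB]; simp [t0]
  have he0B : e0 ∈ B := by rw [hmemB]; simp [e0]; omega
  have hBcc : Bᶜ.card = n - (m + 1) := by
    rw [Finset.card_compl, hBc]; simp
  have rM := real_mcx_one Bᶜ t0 e0 (by omega) (by simpa using ht0B) (by simpa using he0B)
    (by simp [t0, e0])
  rw [hBcc] at rM
  have hM := (hF.comp rM).comp hF'
  obtain ⟨c, hc, hcd⟩ := (hM.mono (le_of_eq (by ring) :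
    _ ≤ 2 * (Nat.log 2 n + 1 + 2 * K * (2 ^ (2 * K) + 1 + 9 * (m + 1)) + 1)
        + (8 * (n - (m + 1)) - 20))).depth_le
  refine ⟨c, ?_, hcd⟩
  intro u
  rw [hc]
  have hsw := prod_swaps x y hinj (List.finRange K) (List.nodup_finRange K)
  rw [← hgeq] at hsw
  obtain ⟨g1, g2, g3⟩ := hsw
  suffices h : mcx Bᶜ t0 (F u) = F (g u) by
    simp only [h, hFF]
  have hQne : ∀ b b' i w, w ≠ t0 → Q b i w = Q b' i w := by
    intro b b' i w hw
    have : (w : ℕ) ≠ 0 := fun h => hw (Fin.ext h)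
    simp [Q, this]
  have hflip : ∀ b i, mcx Bᶜ t0 (fun w => if w ∈ B then Q b i w else true) =
      fun w => if w ∈ B then Q (!b) i w else true := by
    intro b i
    have hall : ∀ j ∈ Bᶜ, (if j ∈ B then Q b i j else true) = true := by
      intro j hj
      rw [if_neg (by simpa using hj)]
    funext w
    simp only [mcx, decide_eq_true hall]
    by_cases hw : w = t0
    · subst hw
      simp [ht0B, hQ0]
    · simp only [hw, if_false]
      rw [hQne b (!b) i w hw]
  have hFx : ∀ i, F (x i) = fun w => if w ∈ B then Q false i w else true :=
    fun i => hFp (Sum.inl i)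
  have hFy : ∀ i, F (y i) = fun w => if w ∈ B then Q true i w else true :=
    fun i => hFp (Sum.inr i)
  by_cases hux : ∃ i, u = x i
  · obtain ⟨i, rfl⟩ := hux
    rw [g1 i (List.mem_finRange i), hFx, hFy, hflip]
    rfl
  by_cases huy : ∃ i, u = y i
  · obtain ⟨i, rfl⟩ := huy
    rw [g2 i (List.mem_finRange i), hFx, hFy, hflip]
    rfl
  push Not at hux huy
  rw [g3 u (fun i _ => ⟨hux i, huy i⟩)]
  have hnot : ¬ ∀ j ∈ Bᶜ, F u j = true := by
    intro hall
    obtain ⟨i, hi⟩ := hQsurj (F u)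
    have hFu : F u = fun w => if w ∈ B then Q (F u t0) i w else true := by
      funext w
      by_cases hw : w ∈ B
      · rw [if_pos hw, hi w hw]
      · rw [if_neg hw, hall w (by simpa using hw)]
    have hFinj : Function.Injective F := Function.LeftInverse.injective hFF
    cases hb : F u t0 with
    | false =>
      rw [hb, ← hFx] at hFu
      exact hux i (hFinj hFu)
    | true =>
      rw [hb, ← hFy] at hFu
      exact huy i (hFinj hFu)
  funext w
  simp only [mcx, decide_eq_false hnot]
  simp

end RevCirc

theorem depth_of_K_disjoint_transpositions :
    ∃ n₀ : ℕ, ∀ n : ℕ, n ≥ n₀ → ∀ K k : ℕ, 2 ≤ K → k = 2 * K →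
      (∃ m : ℕ, k = 2 ^ m) → (k : ℝ) ≤ Real.logb 2 n →
      ∀ g : Equiv.Perm (Fin n → Bool),
        RevCirc.IsProdOfDisjointTranspositions K g →
        ∃ c : List (RevCirc.Gate n), RevCirc.realizes c g ∧
          (RevCirc.depth c : ℝ) ≤ 2 * Real.logb 2 n
            + k * (2 ^ (k + 1) + 32 * Real.logb 2 k)
            + 8 * ((n : ℝ) - Real.logb 2 k) + 6 := by
  refine ⟨1, ?_⟩
  rintro n hn K k hK hk ⟨m', hm'⟩ hlog g hg
  have hn0 : (0 : ℝ) < n := by exact_mod_cast hn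
  have hpow : 2 ^ k ≤ n := by
    rw [Real.le_logb_iff_rpow_le (by norm_num) hn0, Real.rpow_natCast] at hlog
    exact_mod_cast hlog
  obtain ⟨m, rfl⟩ : ∃ m, m' = m + 1 := by
    cases m' with
    | zero => simp at hm'; omega
    | succ m => exact ⟨m, rfl⟩
  have hKm : K = 2 ^ m := by
    rw [pow_succ] at hm'; omega
  have hm : 1 ≤ m := by
    by_contra h
    obtain rfl : m = 0 := by omega
    simp at hKm; omega
  have hlogk : Real.logb 2 k = m + 1 := by
    rw [hm']
    push_cast
    rw [Real.logb_pow]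
    simp
  obtain ⟨c, hc, hd⟩ := RevCirc.main_nat n m K hm hKm (by rw [← hk]; exact hpow) g hg
  refine ⟨c, hc, ?_⟩
  rw [← hk] at hd
  have hkn : k < n := lt_of_lt_of_le Nat.lt_two_pow_self hpow
  have hmk : m + 1 < k := by rw [hm']; exact Nat.lt_two_pow_self
  obtain ⟨c', hc'⟩ : ∃ c', n = c' + (m + 1) := ⟨n - (m + 1), by omega⟩
  have hd2 : RevCirc.depth c ≤ 2 * Nat.log 2 n + k * (2 ^ (k + 1) + 32 * (m + 1)) + 8 * c' + 4 := by
    have h1 : k * (2 ^ k + 1 + 9 * (m + 1)) * 2 ≤ k * (2 ^ (k + 1) + 32 * (m + 1)) := by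
      rw [mul_assoc]
      apply Nat.mul_le_mul_left
      rw [pow_succ]
      omega
    have h2 : n - (m + 1) = c' := by omega
    rw [h2] at hd
    omega
  have hln : (Nat.log 2 n : ℝ) ≤ Real.logb 2 n := Real.natLog_le_logb n 2
  have hd3 : (RevCirc.depth c : ℝ) ≤
      2 * (Nat.log 2 n : ℝ) + k * (2 ^ (k + 1) + 32 * (m + 1)) + 8 * c' + 4 := by
    exact_mod_cast hd2
  have hcr : (n : ℝ) - (m + 1) = c' := by
    rw [hc']; push_cast; ring
  rw [hlogk, hcr]
  linarith
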